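/- The tree automorphisms a, b, c satisfy the relations a² = b² = c² = 1, (ac)⁴ = 1, (ab)⁸ = 1 and (bc)⁸ = 1 in the group of permutations of the set of finite binary words. -/

import Mathlib

/-- The tree automorphism `a` as a function: flips the first letter. -/
def aFun : List Bool → List Bool
  | [] => []
  | x :: w => (!x) :: w

mutual
  /-- The tree automorphism `b` as a function. -/
  def bFun : List Bool → List Bool
    | [] => []
    | false :: w => false :: aFun w
    | true :: w => true :: cFun w
  /-- The tree automorphism `c` as a function. -/
  def cFun : List Bool → List Bool
    | [] => []
    | false :: w => false :: bFun w
    | true :: w => true :: w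
end

theorem aFun_involutive : Function.Involutive aFun := by
  intro w
  cases w with
  | nil => rfl
  | cons x t => cases x <;> rfl

theorem bcFun_involutive : ∀ w, bFun (bFun w) = w ∧ cFun (cFun w) = w := by
  intro w
  induction w with
  | nil => exact ⟨rfl, rfl⟩
  | cons x t ih =>
    cases x
    · exact ⟨by simp [bFun, aFun_involutive t], by simp [cFun, ih.1]⟩
    · exact ⟨by simp [bFun, ih.2], by simp [cFun]⟩

/-- The tree automorphism `a` of the binary rooted tree `{0,1}*`. -/
def treeA : Equiv.Perm (List Bool) := Function.Involutive.toPerm aFun aFun_involutive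

/-- The tree automorphism `b` of the binary rooted tree `{0,1}*`. -/
def treeB : Equiv.Perm (List Bool) :=
  Function.Involutive.toPerm bFun (fun w => (bcFun_involutive w).1)

/-- The tree automorphism `c` of the binary rooted tree `{0,1}*`. -/
def treeC : Equiv.Perm (List Bool) :=
  Function.Involutive.toPerm cFun (fun w => (bcFun_involutive w).2)

/-- If `g` fixes the first letter `x` and acts as `h` on the rest of the word, then `g ^ n` fixes
`x` and acts as `h ^ n` on the rest. -/
theorem perm_pow_cons {g h : Equiv.Perm (List Bool)} {x : Bool}
    (H : ∀ w, g (x :: w) = x :: h w) (n : ℕ) (w : List Bool) :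
    (g ^ n) (x :: w) = x :: (h ^ n) w := by
  induction n with
  | zero => rfl
  | succ n ih => rw [pow_succ', pow_succ', Equiv.Perm.mul_apply, ih, H, Equiv.Perm.mul_apply]

/-- A permutation fixing the empty word and every first letter, and whose restrictions `h₀`, `h₁`
to the two subtrees satisfy `h₀ ^ n = h₁ ^ n = 1`, satisfies `g ^ n = 1`. -/
theorem perm_pow_eq_one_of_sections {g h₀ h₁ : Equiv.Perm (List Bool)} {n : ℕ}
    (hnil : g [] = []) (H₀ : ∀ w, g (false :: w) = false :: h₀ w)
    (H₁ : ∀ w, g (true :: w) = true :: h₁ w) (h₀n : h₀ ^ n = 1) (h₁n : h₁ ^ n = 1) :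
    g ^ n = 1 := by
  ext1 w
  match w with
  | [] => exact Equiv.Perm.pow_apply_eq_self_of_apply_eq_self hnil n
  | false :: w => rw [perm_pow_cons H₀, h₀n]; rfl
  | true :: w => rw [perm_pow_cons H₁, h₁n]; rfl

theorem treeA_apply (w : List Bool) : treeA w = aFun w := rfl

theorem treeB_apply (w : List Bool) : treeB w = bFun w := rfl

theorem treeC_apply (w : List Bool) : treeC w = cFun w := rfl

theorem treeA_sq : treeA ^ 2 = 1 := Equiv.ext aFun_involutive

theorem treeB_sq : treeB ^ 2 = 1 := Equiv.ext fun w => (bcFun_involutive w).1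

theorem treeC_sq : treeC ^ 2 = 1 := Equiv.ext fun w => (bcFun_involutive w).2

theorem treeA_mul_treeC_pow_four : (treeA * treeC) ^ 4 = 1 := by
  rw [pow_mul (treeA * treeC) 2 2]
  refine perm_pow_eq_one_of_sections (h₀ := treeB) (h₁ := treeB) ?_ ?_ ?_ treeB_sq treeB_sq <;>
    simp [pow_two, treeA_apply, treeB_apply, treeC_apply, aFun, cFun]

theorem treeC_mul_treeA_pow_four : (treeC * treeA) ^ 4 = 1 := by
  have hinv : treeC * treeA = (treeA * treeC)⁻¹ := by
    rw [mul_inv_rev]; rfl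
  rw [hinv, inv_pow, treeA_mul_treeC_pow_four, inv_one]

theorem treeA_mul_treeB_pow_eight : (treeA * treeB) ^ 8 = 1 := by
  rw [pow_mul (treeA * treeB) 2 4]
  refine perm_pow_eq_one_of_sections ?_ ?_ ?_ treeC_mul_treeA_pow_four
    treeA_mul_treeC_pow_four <;>
    simp [pow_two, treeA_apply, treeB_apply, treeC_apply, aFun, bFun]

theorem treeB_mul_treeC_pow_eight : (treeB * treeC) ^ 8 = 1 := by
  have hC : treeC ^ 8 = 1 := by rw [pow_mul treeC 2 4, treeC_sq, one_pow]
  refine perm_pow_eq_one_of_sections ?_ ?_ ?_ treeA_mul_treeB_pow_eight hC <;>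
    simp [treeA_apply, treeB_apply, treeC_apply, bFun, cFun]

/-- in the group of permutations of the set of finite binary words,
`a² = b² = c² = 1`, `(ac)⁴ = 1`, `(ab)⁸ = 1` and `(bc)⁸ = 1`. -/
theorem relations_of_tree_generators :
    treeA ^ 2 = 1 ∧ treeB ^ 2 = 1 ∧ treeC ^ 2 = 1 ∧
      (treeA * treeC) ^ 4 = 1 ∧ (treeA * treeB) ^ 8 = 1 ∧ (treeB * treeC) ^ 8 = 1 :=
    ⟨treeA_sq, treeB_sq, treeC_sq, treeA_mul_treeC_pow_four, treeA_mul_treeB_pow_eight,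
    treeB_mul_treeC_pow_eight⟩
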